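/- For the second-order Gaussian kernel (r = 1) and a standard normal target distribution, the exact integrated variance of the kernel distribution function estimator with bandwidth h > 0 based on an i.i.d. sample of size n is IV(h) = (√((h²+1)/π) − h/√π)/n. -/

import Mathlib

open Real MeasureTheory

noncomputable def stdNormalPDF (x : ℝ) : ℝ := (Real.sqrt (2 * Real.pi))⁻¹ * Real.exp (-x ^ 2 / 2)

noncomputable def stdNormalCDF (x : ℝ) : ℝ := ∫ u in Set.Iic x, stdNormalPDF u

open ProbabilityTheory Filter Topology

lemma pdf_eq : stdNormalPDF = gaussianPDFReal 0 1 := by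
  ext x; simp [stdNormalPDF, gaussianPDFReal]

lemma pdf_int : Integrable stdNormalPDF := pdf_eq ▸ integrable_gaussianPDFReal 0 1

lemma pdf_int_one : ∫ x, stdNormalPDF x = 1 := by
  rw [pdf_eq]; exact integral_gaussianPDFReal_eq_one 0 one_ne_zero

lemma pdf_nonneg (x : ℝ) : 0 ≤ stdNormalPDF x := by unfold stdNormalPDF; positivity

lemma pdf_neg (x : ℝ) : stdNormalPDF (-x) = stdNormalPDF x := by simp [stdNormalPDF]

lemma pdf_cont : Continuous stdNormalPDF := by unfold stdNormalPDF; fun_prop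

lemma pdf_deriv (x : ℝ) : HasDerivAt stdNormalPDF (-x * stdNormalPDF x) x := by
  unfold stdNormalPDF
  have h1 : HasDerivAt (fun x : ℝ => -x ^ 2 / 2) (-x) x := by
    have := ((hasDerivAt_pow 2 x).neg.div_const 2)
    exact this.congr_deriv (by norm_num; ring)
  exact (h1.exp.const_mul (Real.sqrt (2 * Real.pi))⁻¹).congr_deriv (by ring)

lemma cdf_eq (x : ℝ) : stdNormalCDF x = (gaussianReal 0 1).real (Set.Iic x) := by
  rw [measureReal_def, gaussianReal_apply_eq_integral 0 one_ne_zero, ENNReal.toReal_ofReal,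
    stdNormalCDF, pdf_eq]
  exact integral_nonneg fun u => gaussianPDFReal_nonneg _ _ _

lemma cdf_nonneg (x : ℝ) : 0 ≤ stdNormalCDF x := by rw [cdf_eq]; positivity

lemma cdf_le_one (x : ℝ) : stdNormalCDF x ≤ 1 := by rw [cdf_eq]; exact measureReal_le_one

lemma cdf_neg (x : ℝ) : stdNormalCDF (-x) = 1 - stdNormalCDF x := by
  have h1 : stdNormalCDF (-x) = ∫ u in Set.Ioi x, stdNormalPDF u := by
    have := integral_comp_neg_Ioi x stdNormalPDF
    simp_rw [pdf_neg] at this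
    rw [this, stdNormalCDF]
  have h2 := setIntegral_union (Set.Iic_disjoint_Ioi (le_refl x)) measurableSet_Ioi
    pdf_int.integrableOn pdf_int.integrableOn
  rw [Set.Iic_union_Ioi, setIntegral_univ, pdf_int_one] at h2
  rw [h1, h2, stdNormalCDF]
  ring

lemma pdf_le (x : ℝ) : stdNormalPDF x ≤ Real.exp x := by
  have h1 : Real.exp (-x ^ 2 / 2) ≤ Real.exp (1/2) * Real.exp x := by
    rw [← Real.exp_add]; apply Real.exp_le_exp.2; nlinarith [sq_nonneg (x+1)]
  have h2 : Real.exp (1/2) ≤ Real.sqrt (2 * Real.pi) := by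
    apply Real.le_sqrt_of_sq_le
    rw [← Real.exp_nat_mul]
    norm_num
    linarith [Real.exp_one_lt_d9, Real.pi_gt_three]
  have h3 : 0 < Real.sqrt (2 * Real.pi) := by positivity
  unfold stdNormalPDF
  rw [inv_mul_le_iff₀ h3]
  exact h1.trans (by gcongr)

lemma cdf_le (x : ℝ) : stdNormalCDF x ≤ Real.exp x := by
  rw [← integral_exp_Iic, stdNormalCDF]
  exact setIntegral_mono pdf_int.integrableOn (integrableOn_exp_Iic x) pdf_le

lemma cdf_deriv (x : ℝ) : HasDerivAt stdNormalCDF (stdNormalPDF x) x := by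
  have h1 : stdNormalCDF = fun x => stdNormalCDF 0 + ∫ u in (0:ℝ)..x, stdNormalPDF u := by
    ext y
    have := intervalIntegral.integral_Iic_sub_Iic (a := 0) (b := y) (pdf_int.integrableOn)
      (pdf_int.integrableOn)
    rw [← this]; simp [stdNormalCDF]
  rw [h1]
  exact (pdf_cont.integral_hasStrictDerivAt 0 x).hasDerivAt.const_add _

lemma cdf_cont : Continuous stdNormalCDF :=
  continuous_iff_continuousAt.2 fun x => (cdf_deriv x).continuousAt

lemma cdf_bot : Tendsto stdNormalCDF atBot (𝓝 0) :=
  squeeze_zero cdf_nonneg cdf_le Real.tendsto_exp_atBot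

lemma pdf_bot : Tendsto stdNormalPDF atBot (𝓝 0) :=
  squeeze_zero pdf_nonneg pdf_le Real.tendsto_exp_atBot

lemma cdf_top : Tendsto stdNormalCDF atTop (𝓝 1) := by
  have := (cdf_bot.comp tendsto_neg_atTop_atBot).const_sub 1
  simpa [Function.comp_def, cdf_neg] using this

noncomputable def psi (x : ℝ) : ℝ := stdNormalCDF x * (1 - stdNormalCDF x)

lemma psi_nonneg (x : ℝ) : 0 ≤ psi x :=
  mul_nonneg (cdf_nonneg x) (by linarith [cdf_le_one x])

lemma psi_neg (x : ℝ) : psi (-x) = psi x := by simp [psi, cdf_neg, mul_comm]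

noncomputable def hh1 (x : ℝ) : ℝ :=
  x * psi x + stdNormalPDF x * (1 - 2 * stdNormalCDF x)

noncomputable def kk (x : ℝ) : ℝ := hh1 x + (Real.sqrt π)⁻¹ * stdNormalCDF (√2 * x)

lemma hh1_neg (x : ℝ) : hh1 (-x) = - hh1 x := by
  simp only [hh1, psi_neg, pdf_neg, cdf_neg]; ring

lemma hh1_bot : Tendsto hh1 atBot (𝓝 0) := by
  have hx : Tendsto (fun x : ℝ => x * stdNormalCDF x) atBot (𝓝 0) := by
    have h0 : Tendsto (fun x : ℝ => |x| * Real.exp x) atBot (𝓝 0) := by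
      have := (Real.tendsto_pow_mul_exp_neg_atTop_nhds_zero 1).comp tendsto_neg_atBot_atTop
      refine this.congr' ?_
      filter_upwards [eventually_le_atBot 0] with x hx
      simp [abs_of_nonpos hx]
    refine squeeze_zero_norm (fun x => ?_) h0
    rw [norm_mul, Real.norm_eq_abs, Real.norm_eq_abs, abs_of_nonneg (cdf_nonneg x)]
    gcongr
    exact cdf_le x
  have h1 := (hx.mul (cdf_bot.const_sub 1)).add
    (pdf_bot.mul ((cdf_bot.const_mul 2).const_sub 1))
  simp only [zero_mul, add_zero] at h1
  refine h1.congr fun x => ?_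
  simp only [hh1, psi]; ring

lemma hh1_top : Tendsto hh1 atTop (𝓝 0) := by
  have := (hh1_bot.comp tendsto_neg_atTop_atBot).neg
  simpa [Function.comp_def, hh1_neg] using this

lemma kk_bot : Tendsto kk atBot (𝓝 0) := by
  have := hh1_bot.add ((cdf_bot.comp (tendsto_id.const_mul_atBot (show (0:ℝ) < √2 by positivity))).const_mul (Real.sqrt π)⁻¹)
  simpa using (show Tendsto kk atBot _ from this)

lemma kk_top : Tendsto kk atTop (𝓝 (Real.sqrt π)⁻¹) := by
  have := hh1_top.add ((cdf_top.comp (tendsto_id.const_mul_atTop (show (0:ℝ) < √2 by positivity))).const_mul (Real.sqrt π)⁻¹)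
  simpa using (show Tendsto kk atTop _ from this)

lemma pdf_sq (x : ℝ) : 2 * stdNormalPDF x ^ 2 = (Real.sqrt π)⁻¹ * (√2 * stdNormalPDF (√2 * x)) := by
  have e : Real.exp (-(√2 * x)^2/2) = Real.exp (-x^2/2)^2 := by
    rw [← Real.exp_nat_mul, mul_pow, Real.sq_sqrt (by norm_num)]
    congr 1; push_cast; ring
  unfold stdNormalPDF
  rw [e, Real.sqrt_mul (by norm_num)]
  have h2 : √2 ^ 2 = 2 := Real.sq_sqrt (by norm_num)
  have hp : 0 < √π := by positivity
  field_simp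
  rw [h2]

lemma kk_deriv (x : ℝ) : HasDerivAt kk (psi x) x := by
  have hF := cdf_deriv x
  have hf := pdf_deriv x
  have hl : HasDerivAt (fun x : ℝ => √2 * x) √2 x := by
    simpa using (hasDerivAt_id x).const_mul √2
  have hs := ((cdf_deriv (√2 * x)).comp x hl).const_mul (Real.sqrt π)⁻¹
  have hp := hF.mul (hF.const_sub 1)
  have := (((hasDerivAt_id x).mul hp).add (hf.mul ((hF.const_mul 2).const_sub 1))).add hs
  refine this.congr_deriv ?_
  have := pdf_sq x
  simp only [psi, id, Pi.mul_apply]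
  linear_combination -this

lemma psi_int : Integrable psi := by
  have h1 : IntegrableOn psi (Set.Ioi 0) :=
    integrableOn_Ioi_deriv_of_nonneg' (fun x _ => kk_deriv x) (fun x _ => psi_nonneg x) kk_top
  have h2 : IntegrableOn psi (Set.Iic 0) := by
    rw [← integrableOn_Ici_iff_integrableOn_Ioi] at h1
    have := h1.comp_neg
    simpa [psi_neg] using this
  have := h2.union h1
  rwa [Set.Iic_union_Ioi, integrableOn_univ] at this

lemma psi_integral : ∫ x, psi x = (Real.sqrt π)⁻¹ := by
  rw [integral_of_hasDerivAt_of_tendsto kk_deriv psi_int kk_bot kk_top, sub_zero]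

lemma gauss_scale (s : ℝ) (hs : 0 < s) (x : ℝ) :
    (gaussianReal 0 (NNReal.mk (s ^ 2) (sq_nonneg s))).real (Set.Iic x) = stdNormalCDF (x / s) := by
  have := gaussianReal_map_const_mul (μ := 0) (v := 1) s
  rw [mul_zero, mul_one] at this
  rw [← this, map_measureReal_apply (by fun_prop) measurableSet_Iic, cdf_eq]
  congr 1
  ext y
  simp [le_div_iff₀ hs, mul_comm]

lemma conv_cdf (h : ℝ) (hh : 0 < h) (x : ℝ) :
    ∫ y : ℝ, stdNormalCDF ((x - y) / h) * stdNormalPDF y = stdNormalCDF (x / √(h ^ 2 + 1)) := by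
  have hs : 0 < √(h ^ 2 + 1) := by positivity
  rw [← gauss_scale _ hs]
  have hc := gaussianReal_conv_gaussianReal (m₁ := 0) (m₂ := 0) (v₁ := 1)
    (v₂ := NNReal.mk (h ^ 2) (sq_nonneg h))
  have hv : (1 : NNReal) + NNReal.mk (h ^ 2) (sq_nonneg h) = NNReal.mk (√(h ^ 2 + 1) ^ 2) (sq_nonneg _) := by
    apply NNReal.eq
    rw [NNReal.coe_add]
    simp only [NNReal.coe_mk, NNReal.coe_one]
    rw [Real.sq_sqrt (by positivity), add_comm]
  rw [hv, add_zero] at hc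
  rw [← hc, measureReal_def, ← lintegral_indicator_one measurableSet_Iic,
    Measure.lintegral_conv (measurable_one.indicator measurableSet_Iic)]
  have h1 : ∀ y : ℝ, ∫⁻ z, (Set.Iic x).indicator (1 : ℝ → ENNReal) (y + z)
      ∂(gaussianReal 0 (NNReal.mk (h ^ 2) (sq_nonneg h))) = ENNReal.ofReal (stdNormalCDF ((x - y) / h)) := by
    intro y
    rw [← gauss_scale h hh, measureReal_def, ENNReal.ofReal_toReal (measure_ne_top _ _),
      ← lintegral_indicator_one measurableSet_Iic]
    congr 1
    ext z
    simp [Set.indicator, le_sub_iff_add_le, add_comm]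
  simp_rw [h1]
  rw [← integral_eq_lintegral_of_nonneg_ae (ae_of_all _ fun y => cdf_nonneg _)
    (by have := cdf_cont; exact Continuous.aestronglyMeasurable (by fun_prop)),
    integral_gaussianReal_eq_integral_smul one_ne_zero, pdf_eq]
  simp [mul_comm]

lemma cdf_pow_int (h x : ℝ) (k : ℕ) :
    Integrable fun y : ℝ => stdNormalCDF ((x - y) / h) ^ k * stdNormalPDF y := by
  refine pdf_int.bdd_mul (c := 1) ?_ ?_
  · have := cdf_cont; exact Continuous.aestronglyMeasurable (by fun_prop)
  · refine ae_of_all _ fun y => ?_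
    rw [norm_pow, Real.norm_eq_abs, abs_of_nonneg (cdf_nonneg _)]
    exact pow_le_one₀ (cdf_nonneg _) (cdf_le_one _)

/-- Integrated variance of the second-order Gaussian KDFE for a standard normal target:
    IV(h) = n⁻¹ ∫ ( E[Φ((x−X)/h)²] − (E[Φ((x−X)/h)])² ) dx with X ~ N(0,1). -/
theorem exact_IV_gaussian_kernel_normal (n : ℕ) (hn : 1 ≤ n) (h : ℝ) (hh : 0 < h) :
    (n : ℝ)⁻¹ *
        ∫ x : ℝ,
          ((∫ y : ℝ, stdNormalCDF ((x - y) / h) ^ 2 * stdNormalPDF y) -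
            (∫ y : ℝ, stdNormalCDF ((x - y) / h) * stdNormalPDF y) ^ 2)
      = (Real.sqrt ((h ^ 2 + 1) / Real.pi) - h / Real.sqrt Real.pi) / n := by
  have hs : 0 < √(h ^ 2 + 1) := by positivity
  have hpsi : Integrable fun u : ℝ => psi (u / h) := psi_int.comp_div hh.ne'
  have hpsi2 : Integrable fun u : ℝ => psi (u / √(h ^ 2 + 1)) := psi_int.comp_div hs.ne'
  have key : ∀ x : ℝ, ((∫ y : ℝ, stdNormalCDF ((x - y) / h) ^ 2 * stdNormalPDF y) -
            (∫ y : ℝ, stdNormalCDF ((x - y) / h) * stdNormalPDF y) ^ 2)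
      = psi (x / √(h ^ 2 + 1)) -
        (convolution stdNormalPDF (fun u => psi (u / h)) (ContinuousLinearMap.mul ℝ ℝ) volume) x := by
    intro x
    have e : (convolution stdNormalPDF (fun u => psi (u / h)) (ContinuousLinearMap.mul ℝ ℝ) volume) x
        = (∫ y : ℝ, stdNormalCDF ((x - y) / h) * stdNormalPDF y) -
          ∫ y : ℝ, stdNormalCDF ((x - y) / h) ^ 2 * stdNormalPDF y := by
      have i1 := cdf_pow_int h x 1
      simp only [pow_one] at i1
      rw [← integral_sub i1 (cdf_pow_int h x 2), convolution]
      congr 1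
      ext y
      simp only [ContinuousLinearMap.mul_apply', psi]; ring
    rw [e, conv_cdf h hh, psi]; ring
  simp_rw [key]
  rw [integral_sub hpsi2 (pdf_int.integrable_convolution _ hpsi),
    integral_convolution _ pdf_int hpsi, pdf_int_one, Measure.integral_comp_div,
    Measure.integral_comp_div, psi_integral, abs_of_pos hh, abs_of_pos hs,
    Real.sqrt_div (by positivity)]
  simp only [ContinuousLinearMap.mul_apply', smul_eq_mul]
  ring
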